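/- Let μ be a valuation on 𝒞ⁿ which is rigid motion invariant, monotone decreasing, and simple, and let f : ℝ ∪ {∞} → [0, ∞) be a decreasing function with f(∞) = 0 such that μ(t + I_K) = f(t)·vol_n(K) for every convex body K and every t ∈ ℝ. Let K be a convex body, let {K₁, …, K_N} be an inductive partition of K, and let u ∈ 𝒞ⁿ be such that L = dom(u) is a convex body, the restriction of u to L is continuous, and int(L) ⊆ K. Then Σ_{i=1}^N m_i·vol_n(K_i) ≤ μ(u + I_K) ≤ Σ_{i=1}^N M_i·vol_n(K_i), where m_i = inf{f(u(x)) : x ∈ K_i} and M_i = sup{f(u(x)) : x ∈ K_i}. -/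

import Mathlib

open MeasureTheory Filter Set
open scoped ENNReal RealInnerProductSpace

noncomputable section

abbrev En (n : ℕ) : Type := EuclideanSpace ℝ (Fin n)

def IsCn {n : ℕ} (u : En n → EReal) : Prop :=
  (∀ x, u x ≠ ⊥) ∧
  (∀ x y : En n, ∀ a b : ℝ, 0 ≤ a → 0 ≤ b → a + b = 1 →
    u (a • x + b • y) ≤ (a : EReal) * u x + (b : EReal) * u y) ∧
  LowerSemicontinuous u ∧
  Tendsto u (cocompact (En n)) atTop

def IsValuation {n : ℕ} (μ : (En n → EReal) → ℝ) : Prop :=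
  μ (fun _ => ⊤) = 0 ∧
  ∀ u v : En n → EReal, IsCn u → IsCn v → IsCn (fun x => min (u x) (v x)) →
    μ (fun x => max (u x) (v x)) + μ (fun x => min (u x) (v x)) = μ u + μ v

def RigidInvariant {n : ℕ} (μ : (En n → EReal) → ℝ) : Prop :=
  ∀ u : En n → EReal, IsCn u → ∀ (R : En n ≃ₗᵢ[ℝ] En n) (x₀ : En n),
    μ (fun x => u (R x + x₀)) = μ u

def MonotoneDecr {n : ℕ} (μ : (En n → EReal) → ℝ) : Prop :=
  ∀ u v : En n → EReal, IsCn u → IsCn v → (∀ x, v x ≤ u x) → μ u ≤ μ v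

def MContinuous {n : ℕ} (μ : (En n → EReal) → ℝ) : Prop :=
  ∀ (u : En n → EReal) (useq : ℕ → En n → EReal), IsCn u → (∀ i, IsCn (useq i)) →
    (∀ i x, useq (i + 1) x ≤ useq i x) → (∀ i x, u x ≤ useq i x) →
    (∀ x ∈ intrinsicInterior ℝ {y | u y ≠ ⊤},
      Tendsto (fun i => useq i x) atTop (nhds (u x))) →
    Tendsto (fun i => μ (useq i)) atTop (nhds (μ u))

def HomogVal {n : ℕ} (μ : (En n → EReal) → ℝ) (α : ℝ) : Prop :=
  ∀ u : En n → EReal, IsCn u → ∀ l : ℝ, 0 < l →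
    μ (fun x => u (l⁻¹ • x)) = l ^ α * μ u

def SimpleVal {n : ℕ} (μ : (En n → EReal) → ℝ) : Prop :=
  ∀ u : En n → EReal, IsCn u → interior {x | u x ≠ ⊤} = ∅ → μ u = 0

def IsConvexBody {n : ℕ} (K : Set (En n)) : Prop :=
  K.Nonempty ∧ IsCompact K ∧ Convex ℝ K

open Classical in
noncomputable def constOn {n : ℕ} (t : ℝ) (K : Set (En n)) : En n → EReal :=
  fun x => if x ∈ K then (t : EReal) else ⊤

open Classical in
noncomputable def restrictTo {n : ℕ} (u : En n → EReal) (K : Set (En n)) : En n → EReal :=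
  fun x => if x ∈ K then u x else ⊤

def IsConvexPartition {n : ℕ} (K : Set (En n)) (P : Finset (Set (En n))) : Prop :=
  (∀ Q ∈ P, IsConvexBody Q) ∧ (⋃ Q ∈ P, Q) = K ∧
  ∀ Q ∈ P, ∀ R ∈ P, Q ≠ R → interior (Q ∩ R) = ∅

def IsInductivePartition {n : ℕ} (K : Set (En n)) (P : Finset (Set (En n))) : Prop :=
  IsConvexPartition K P ∧
  ∃ (l : ℕ) (H : Fin (l + 1) → Set (En n)),
    H (Fin.last l) = K ∧ (∀ i, IsConvexBody (H i)) ∧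
    ∀ i : Fin (l + 1), H i ∈ P ∨ ∃ j k : Fin (l + 1), j < i ∧ k < i ∧
      H i = H j ∪ H k ∧ interior (H j ∩ H k) = ∅

def IsPolytope {n : ℕ} (P : Set (En n)) : Prop :=
  ∃ S : Finset (En n), S.Nonempty ∧ P = convexHull ℝ (S : Set (En n))

def ContainsFacet {n : ℕ} (v : En n) (c : ℝ) (Q : Set (En n)) : Prop :=
  (Q ⊆ {x | ⟪v, x⟫ ≤ c} ∨ Q ⊆ {x | c ≤ ⟪v, x⟫}) ∧
  Module.finrank ℝ (affineSpan ℝ (Q ∩ {x | ⟪v, x⟫ = c})).direction = n - 1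

open Classical in
noncomputable def refinePartition {n : ℕ} (P : Finset (Set (En n))) (v : En n) (c : ℝ) :
    Finset (Set (En n)) :=
  ((P.image fun Q => Q ∩ {x | ⟪v, x⟫ ≤ c}).filter fun Q => (interior Q).Nonempty) ∪
  ((P.image fun Q => Q ∩ {x | c ≤ ⟪v, x⟫}).filter fun Q => (interior Q).Nonempty)


theorem isCn_restrictTo {n : ℕ} {v : En n → EReal} (hbot : ∀ x, v x ≠ ⊥)
    (hconv : ∀ x y : En n, ∀ a b : ℝ, 0 ≤ a → 0 ≤ b → a + b = 1 →
      v (a • x + b • y) ≤ (a : EReal) * v x + (b : EReal) * v y)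
    (hlsc : LowerSemicontinuous v) {A : Set (En n)} (hA : IsCompact A) (hAc : Convex ℝ A) :
    IsCn (restrictTo v A) := by
  have hbot' : ∀ x, restrictTo v A x ≠ ⊥ := by
    intro x
    unfold restrictTo
    split_ifs
    · exact hbot x
    · exact top_ne_bot
  have hmul : ∀ (c : ℝ) (x : En n), 0 < c → (c : EReal) * restrictTo v A x ≠ ⊥ := by
    intro c x hc h
    rw [EReal.mul_eq_bot] at h
    have hc' : (0 : EReal) < c := by exact_mod_cast hc
    rcases h with h | h | h | h
    · exact EReal.coe_ne_bot _ h.1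
    · exact hbot' x h.2
    · exact EReal.coe_ne_top _ h.1
    · exact absurd h.1 (not_lt.2 hc'.le)
  refine ⟨hbot', ?_, ?_, ?_⟩
  · intro x y a b ha hb hab
    rcases ha.eq_or_lt with rfl | ha'
    · obtain rfl : b = 1 := by linarith
      simp
    rcases hb.eq_or_lt with rfl | hb'
    · obtain rfl : a = 1 := by linarith
      simp
    by_cases hx : x ∈ A
    · by_cases hy : y ∈ A
      · simpa [restrictTo, hx, hy, hAc hx hy ha hb hab] using hconv x y a b ha hb hab
      · have : restrictTo v A y = ⊤ := by simp [restrictTo, hy]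
        rw [this, EReal.coe_mul_top_of_pos hb', EReal.add_top_of_ne_bot (hmul a x ha')]
        exact le_top
    · have : restrictTo v A x = ⊤ := by simp [restrictTo, hx]
      rw [this, EReal.coe_mul_top_of_pos ha', EReal.top_add_of_ne_bot (hmul b y hb')]
      exact le_top
  · intro x c hc
    by_cases hx : x ∈ A
    · simp only [restrictTo, hx, if_true] at hc
      filter_upwards [hlsc x c hc] with z hz
      unfold restrictTo
      split_ifs
      · exact hz
      · exact hz.trans_le le_top
    · filter_upwards [hA.isClosed.isOpen_compl.mem_nhds hx] with z hz
      have hz' : z ∉ A := hz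
      simpa [restrictTo, hz', hx] using hc
  · refine tendsto_atTop.2 fun c => ?_
    filter_upwards [hA.compl_mem_cocompact] with z hz
    have hz' : z ∉ A := hz
    simp [restrictTo, hz']

theorem IsCn.restrictTo {n : ℕ} {u : En n → EReal} (hu : IsCn u) {A : Set (En n)}
    (hA : IsCompact A) (hAc : Convex ℝ A) : IsCn (restrictTo u A) :=
  isCn_restrictTo hu.1 hu.2.1 hu.2.2.1 hA hAc

theorem isCn_constOn {n : ℕ} (t : ℝ) {A : Set (En n)} (hA : IsCompact A) (hAc : Convex ℝ A) :
    IsCn (constOn t A) := by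
  refine isCn_restrictTo (v := fun _ => (t : EReal)) (fun _ => EReal.coe_ne_bot t) ?_
    lowerSemicontinuous_const hA hAc
  intro _ _ a b _ _ hab
  have : t = a * t + b * t := by rw [← add_mul, hab, one_mul]
  exact_mod_cast this.le

theorem interior_biUnion_finset_eq_empty {X : Type*} [TopologicalSpace X] {ι : Type*}
    (S : Finset ι) (F : ι → Set X) (hF : ∀ i ∈ S, IsClosed (F i))
    (hint : ∀ i ∈ S, interior (F i) = ∅) : interior (⋃ i ∈ S, F i) = ∅ := by
  classical
  induction S using Finset.induction_on with
  | empty => simp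
  | insert i S _ ih =>
    rw [Finset.set_biUnion_insert, interior_union_isClosed_of_interior_empty
      (hF i (Finset.mem_insert_self i S))
      (ih (fun j hj => hF j (Finset.mem_insert_of_mem hj))
        (fun j hj => hint j (Finset.mem_insert_of_mem hj)))]
    exact hint i (Finset.mem_insert_self i S)

theorem SimpleVal.restrictTo_eq_zero {n : ℕ} {μ : (En n → EReal) → ℝ} (hsimple : SimpleVal μ)
    {u : En n → EReal} (hu : IsCn u) {A : Set (En n)} (hA : IsCompact A) (hAc : Convex ℝ A)
    (hint : interior A = ∅) : μ (restrictTo u A) = 0 := by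
  refine hsimple _ (hu.restrictTo hA hAc) (subset_eq_empty (interior_mono fun x hx => ?_) hint)
  by_contra h
  simp [restrictTo, h] at hx

theorem IsValuation.restrictTo_union {n : ℕ} {μ : (En n → EReal) → ℝ} (hval : IsValuation μ)
    (hsimple : SimpleVal μ) {u : En n → EReal} (hu : IsCn u) {A B : Set (En n)}
    (hA : IsConvexBody A) (hB : IsConvexBody B) (hAB : IsConvexBody (A ∪ B))
    (hint : interior (A ∩ B) = ∅) :
    μ (restrictTo u (A ∪ B)) = μ (restrictTo u A) + μ (restrictTo u B) := by
  have hmin : (fun x => min (restrictTo u A x) (restrictTo u B x)) = restrictTo u (A ∪ B) := by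
    funext x
    by_cases h1 : x ∈ A <;> by_cases h2 : x ∈ B <;> simp [restrictTo, h1, h2]
  have hmax : (fun x => max (restrictTo u A x) (restrictTo u B x)) = restrictTo u (A ∩ B) := by
    funext x
    by_cases h1 : x ∈ A <;> by_cases h2 : x ∈ B <;> simp [restrictTo, h1, h2]
  have h := hval.2 _ _ (hu.restrictTo hA.2.1 hA.2.2) (hu.restrictTo hB.2.1 hB.2.2)
    (hmin ▸ hu.restrictTo hAB.2.1 hAB.2.2)
  rwa [hmin, hmax, hsimple.restrictTo_eq_zero hu (hA.2.1.inter hB.2.1) (hA.2.2.inter hB.2.2) hint,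
    zero_add] at h

theorem IsInductivePartition.restrictTo_eq_sum {n : ℕ} {μ : (En n → EReal) → ℝ}
    (hval : IsValuation μ) (hsimple : SimpleVal μ) {u : En n → EReal} (hu : IsCn u)
    {K : Set (En n)} {P : Finset (Set (En n))} (hP : IsInductivePartition K P) :
    μ (restrictTo u K) = ∑ Q ∈ P, μ (restrictTo u Q) := by
  classical
  obtain ⟨⟨hbody, hunion, hdisj⟩, l, H, hlast, hH, hstep⟩ := hP
  have key : ∀ i, ∃ S ⊆ P, H i = ⋃ Q ∈ S, Q ∧
      μ (restrictTo u (H i)) = ∑ Q ∈ S, μ (restrictTo u Q) := by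
    intro i
    induction i using WellFoundedLT.induction with
    | ind i ih =>
      rcases hstep i with hi | ⟨j, k, hj, hk, hjk, hint⟩
      · exact ⟨{H i}, by simpa using hi, by simp, by simp⟩
      · obtain ⟨S, hS, hSU, hSμ⟩ := ih j hj
        obtain ⟨T, hT, hTU, hTμ⟩ := ih k hk
        refine ⟨S ∪ T, Finset.union_subset hS hT, ?_, ?_⟩
        · rw [Finset.set_biUnion_union, ← hSU, ← hTU, hjk]
        · have hinter : ∑ Q ∈ S ∩ T, μ (restrictTo u Q) = 0 := by
            refine Finset.sum_eq_zero fun Q hQ => ?_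
            obtain ⟨hQS, hQT⟩ := Finset.mem_inter.1 hQ
            have hQj : Q ⊆ H j := hSU ▸ subset_biUnion_of_mem (u := fun R : Set (En n) => R) hQS
            have hQk : Q ⊆ H k := hTU ▸ subset_biUnion_of_mem (u := fun R : Set (En n) => R) hQT
            have hQb := hbody Q (hS hQS)
            exact hsimple.restrictTo_eq_zero hu hQb.2.1 hQb.2.2
              (subset_eq_empty (interior_mono (subset_inter hQj hQk)) hint)
          have hsum := Finset.sum_union_inter (s₁ := S) (s₂ := T)
            (f := fun Q => μ (restrictTo u Q))
          rw [hinter, add_zero] at hsum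
          rw [hsum, ← hSμ, ← hTμ, hjk]
          exact hval.restrictTo_union hsimple hu (hH j) (hH k) (hjk ▸ hH i) hint
  obtain ⟨S, hS, hSU, hSμ⟩ := key (Fin.last l)
  rw [hlast] at hSU hSμ
  rw [hSμ]
  refine Finset.sum_subset hS fun Q hQ hQS => ?_
  have hQb := hbody Q hQ
  refine hsimple.restrictTo_eq_zero hu hQb.2.1 hQb.2.2 ?_
  have hcover : Q ⊆ ⋃ R ∈ S, Q ∩ R := by
    intro x hx
    have hxK : x ∈ K := hunion ▸ mem_biUnion (s := (P : Set (Set (En n)))) hQ hx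
    rw [hSU] at hxK
    simp only [mem_iUnion] at hxK ⊢
    obtain ⟨R, hR, hxR⟩ := hxK
    exact ⟨R, hR, hx, hxR⟩
  refine subset_eq_empty (interior_mono hcover) (interior_biUnion_finset_eq_empty S _ ?_ ?_)
  · exact fun R hR => hQb.2.1.isClosed.inter (hbody R (hS hR)).2.1.isClosed
  · exact fun R hR => hdisj Q hQ R (hS hR) fun h => hQS (h ▸ hR)

theorem restrictTo_le_sSup_mul_volume {n : ℕ} {μ : (En n → EReal) → ℝ} (hval : IsValuation μ)
    (hmono : MonotoneDecr μ) {f : EReal → ℝ} (hf0 : ∀ t, 0 ≤ f t)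
    (hfdec : ∀ s t : EReal, s ≤ t → f t ≤ f s)
    (hμf : ∀ K : Set (En n), IsConvexBody K → ∀ t : ℝ,
      μ (constOn t K) = f (t : EReal) * (volume K).toReal)
    {u : En n → EReal} (hu : IsCn u) {Q : Set (En n)} (hQ : IsConvexBody Q) :
    μ (restrictTo u Q) ≤ sSup ((fun x => f (u x)) '' Q) * (volume Q).toReal := by
  obtain ⟨x₀, hx₀, hmin⟩ := (hu.2.2.1.lowerSemicontinuousOn Q).exists_isMinOn hQ.1 hQ.2.1
  by_cases htop : u x₀ = ⊤
  · have : restrictTo u Q = fun _ => ⊤ := by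
      funext x
      unfold restrictTo
      split_ifs with hx
      · exact top_le_iff.1 (htop ▸ hmin hx)
      · rfl
    rw [this, hval.1]
    refine mul_nonneg (Real.sSup_nonneg ?_) ENNReal.toReal_nonneg
    rintro _ ⟨x, -, rfl⟩
    exact hf0 _
  · lift u x₀ to ℝ using ⟨htop, hu.1 x₀⟩ with t ht
    have hle : μ (restrictTo u Q) ≤ μ (constOn t Q) := by
      refine hmono _ _ (hu.restrictTo hQ.2.1 hQ.2.2) (isCn_constOn t hQ.2.1 hQ.2.2) fun x => ?_
      unfold restrictTo constOn
      split_ifs with hx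
      · exact ht ▸ hmin hx
      · exact le_rfl
    rw [hμf Q hQ] at hle
    refine hle.trans (mul_le_mul_of_nonneg_right ?_ ENNReal.toReal_nonneg)
    refine le_csSup ⟨f t, ?_⟩ ⟨x₀, hx₀, by simp [← ht]⟩
    rintro _ ⟨x, hx, rfl⟩
    exact hfdec _ _ (ht ▸ hmin hx)

theorem sInf_mul_volume_le_restrictTo {n : ℕ} {μ : (En n → EReal) → ℝ} (hval : IsValuation μ)
    (hmono : MonotoneDecr μ) {f : EReal → ℝ} (hf0 : ∀ t, 0 ≤ f t) (hftop : f ⊤ = 0)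
    (hμf : ∀ K : Set (En n), IsConvexBody K → ∀ t : ℝ,
      μ (constOn t K) = f (t : EReal) * (volume K).toReal)
    {u : En n → EReal} (hu : IsCn u) (hcont : ContinuousOn u {x | u x ≠ ⊤})
    {Q : Set (En n)} (hQ : IsConvexBody Q) :
    sInf ((fun x => f (u x)) '' Q) * (volume Q).toReal ≤ μ (restrictTo u Q) := by
  have hbdd : BddBelow ((fun x => f (u x)) '' Q) := by
    refine ⟨0, ?_⟩
    rintro _ ⟨x, -, rfl⟩
    exact hf0 _
  have hcn := hu.restrictTo hQ.2.1 hQ.2.2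
  by_cases hsub : Q ⊆ {x | u x ≠ ⊤}
  · obtain ⟨x₀, hx₀, hmax⟩ := hQ.2.1.exists_isMaxOn hQ.1 (hcont.mono hsub)
    have htop : u x₀ ≠ ⊤ := hsub hx₀
    lift u x₀ to ℝ using ⟨htop, hu.1 x₀⟩ with t ht
    have hle : μ (constOn t Q) ≤ μ (restrictTo u Q) := by
      refine hmono _ _ (isCn_constOn t hQ.2.1 hQ.2.2) hcn fun x => ?_
      unfold restrictTo constOn
      split_ifs with hx
      · exact ht ▸ hmax hx
      · exact le_rfl
    rw [hμf Q hQ] at hle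
    refine le_trans (mul_le_mul_of_nonneg_right ?_ ENNReal.toReal_nonneg) hle
    exact csInf_le hbdd ⟨x₀, hx₀, by simp [← ht]⟩
  · obtain ⟨x₀, hx₀, hx₀top⟩ := not_subset.1 hsub
    have htop : u x₀ = ⊤ := by simpa using hx₀top
    have hinf : sInf ((fun x => f (u x)) '' Q) ≤ 0 :=
      csInf_le hbdd ⟨x₀, hx₀, by simp [htop, hftop]⟩
    have hempty : IsCn (fun _ : En n => (⊤ : EReal)) := by
      simpa +unfoldPartialApp [restrictTo] using hu.restrictTo isCompact_empty convex_empty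
    have hnonneg : μ (fun _ => ⊤) ≤ μ (restrictTo u Q) := hmono _ _ hempty hcn fun _ => le_top
    rw [hval.1] at hnonneg
    exact (mul_nonpos_of_nonpos_of_nonneg hinf ENNReal.toReal_nonneg).trans hnonneg

theorem stmt12 {n : ℕ} (μ : (En n → EReal) → ℝ)
    (hval : IsValuation μ) (hinv : RigidInvariant μ) (hmono : MonotoneDecr μ)
    (hsimple : SimpleVal μ)
    (f : EReal → ℝ) (hf0 : ∀ t, 0 ≤ f t) (hfdec : ∀ s t : EReal, s ≤ t → f t ≤ f s)
    (hftop : f ⊤ = 0)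
    (hμf : ∀ K : Set (En n), IsConvexBody K → ∀ t : ℝ,
      μ (constOn t K) = f (t : EReal) * (volume K).toReal)
    (K : Set (En n)) (hK : IsConvexBody K)
    (Ppart : Finset (Set (En n))) (hind : IsInductivePartition K Ppart)
    (u : En n → EReal) (hu : IsCn u) (L : Set (En n)) (hL : IsConvexBody L)
    (hdom : {x | u x ≠ ⊤} = L) (hcont : ContinuousOn u L)
    (hLK : interior L ⊆ K) :
    ∑ Q ∈ Ppart, sInf ((fun x => f (u x)) '' Q) * (volume Q).toReal ≤ μ (restrictTo u K) ∧
    μ (restrictTo u K) ≤ ∑ Q ∈ Ppart, sSup ((fun x => f (u x)) '' Q) * (volume Q).toReal := by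
  rw [hind.restrictTo_eq_sum hval hsimple hu]
  exact ⟨Finset.sum_le_sum fun Q hQ => sInf_mul_volume_le_restrictTo hval hmono hf0 hftop hμf hu
      (hdom ▸ hcont) (hind.1.1 Q hQ),
    Finset.sum_le_sum fun Q hQ => restrictTo_le_sSup_mul_volume hval hmono hf0 hfdec hμf hu
      (hind.1.1 Q hQ)⟩
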